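/- arXiv:1603.04926 — 2 statements merged into one kernel-verified Lean document; each statement's English description precedes it below -/
import Mathlib

section
/- Let R be a commutative ring and let A = R[χ₁^{±1}, χ₂^{±1}] be the Laurent polynomial ring in two variables. The R-algebra homomorphism φ from R[x₁^{±1}, x₂^{±1}, x₃^{±1}, x₄^{±1}] to the product ring A⁴ determined by x₁ ↦ (χ₁, 1, 1, χ₁), x₂ ↦ (χ₂, χ₂, 1, 1), x₃ ↦ (1, χ₁^{−1}, χ₁^{−1}, 1), x₄ ↦ (1, 1, χ₂^{−1}, χ₂^{−1}) has kernel equal to the ideal generated by (x₁ − 1)(x₃ − 1) and (x₂ − 1)(x₄ − 1), and its image equals the subring {(f₁, f₂, f₃, f₄) ∈ A⁴ : f₁ − f₂ ∈ (1 − χ₁)A, f₂ − f₃ ∈ (1 − χ₂)A, f₃ − f₄ ∈ (1 − χ₁)A, f₄ − f₁ ∈ (1 − χ₂)A}. -/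
/-!
STATEMENT 2: Comparison of the Reisner–Stanley and GKM presentations of the
T-equivariant K-theory of the toric surface ℙ¹ × ℙ¹.

`A = R[χ₁^{±1}, χ₂^{±1}]` is realized as `AddMonoidAlgebra R (ℤ × ℤ)`, with
`χ₁ = single (1,0) 1`, `χ₂ = single (0,1) 1`.
`R[x₁^{±1}, x₂^{±1}, x₃^{±1}, x₄^{±1}]` is realized as
`AddMonoidAlgebra R (ℤ × ℤ × ℤ × ℤ)`.  The product ring `A⁴` is realized as `Fin 4 → A`.
-/

/-- The Laurent monomial with exponent vector `v` in `R[x₁^{±1}, x₂^{±1}, x₃^{±1}, x₄^{±1}]`. -/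
noncomputable abbrev xMon (R : Type*) [CommRing R] (v : ℤ × ℤ × ℤ × ℤ) :
    AddMonoidAlgebra R (ℤ × ℤ × ℤ × ℤ) :=
  AddMonoidAlgebra.single v 1

/-- The Laurent monomial with exponent vector `v` in `A = R[χ₁^{±1}, χ₂^{±1}]`. -/
noncomputable abbrev chiMon (R : Type*) [CommRing R] (v : ℤ × ℤ) :
    AddMonoidAlgebra R (ℤ × ℤ) :=
  AddMonoidAlgebra.single v 1

namespace AddMonoidAlgebra

variable {R G H : Type*} [CommRing R] [AddCommGroup G]

lemma single_sub_one_dvd_single_zsmul_sub_one (g : G) (n : ℤ) :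
    (single g 1 - 1 : AddMonoidAlgebra R G) ∣ single (n • g) 1 - 1 := by
  induction n using Int.induction_on with
  | zero => simp [one_def]
  | succ n ih =>
    have h : (single (((n : ℤ) + 1) • g) 1 : AddMonoidAlgebra R G) =
        single ((n : ℤ) • g) 1 * single g 1 := by
      rw [single_mul_single, add_smul, one_smul, one_mul]
    have h' : (single (((n : ℤ) + 1) • g) 1 - 1 : AddMonoidAlgebra R G) =
        (single g 1 - 1) * single ((n : ℤ) • g) 1 + (single ((n : ℤ) • g) 1 - 1) := by
      rw [h]; ring
    rw [h']
    exact dvd_add (dvd_mul_right _ _) ih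
  | pred n ih =>
    have h : (single ((-(n : ℤ)) • g) 1 : AddMonoidAlgebra R G) =
        single ((-(n : ℤ) - 1) • g) 1 * single g 1 := by
      rw [single_mul_single, sub_smul, one_smul, one_mul, sub_add_cancel]
    have h' : (single ((-(n : ℤ) - 1) • g) 1 - 1 : AddMonoidAlgebra R G) =
        (single ((-(n : ℤ)) • g) 1 - 1) - (single g 1 - 1) * single ((-(n : ℤ) - 1) • g) 1 := by
      rw [h]; ring
    rw [h']
    exact dvd_sub ih (dvd_mul_right _ _)

lemma single_sub_single_mem_span {g v w : G} (n : ℤ) (h : v = w + n • g) (r : R) :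
    (single v r - single w r : AddMonoidAlgebra R G) ∈ Ideal.span {1 - single g 1} := by
  have h' : (single v r - single w r : AddMonoidAlgebra R G) =
      (single (n • g) 1 - 1) * single w r := by
    rw [sub_mul, one_mul, single_mul_single, one_mul, h, add_comm]
  rw [h', Ideal.mem_span_singleton, ← neg_sub, neg_dvd]
  exact (single_sub_one_dvd_single_zsmul_sub_one g n).mul_right _

lemma mapDomain_eq_of_sub_mem_span {g : G} (e : G → H) (he : ∀ v, e (g + v) = e v)
    {x y : AddMonoidAlgebra R G} (h : x - y ∈ Ideal.span {1 - single g 1}) :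
    mapDomain e x = mapDomain e y := by
  obtain ⟨c, hc⟩ := Ideal.mem_span_singleton.1 h
  have key : ∀ c : AddMonoidAlgebra R G, mapDomain e (single g 1 * c) = mapDomain e c := by
    intro c
    induction c using induction_linear with
    | zero => simp
    | add x y hx hy => rw [mul_add, mapDomain_add, mapDomain_add, hx, hy]
    | single v r => rw [single_mul_single, mapDomain_single, mapDomain_single, he, one_mul]
  have hxy : x + single g 1 * c = y + c := by linear_combination hc
  have := congrArg (mapDomain e) hxy
  rwa [mapDomain_add, mapDomain_add, key, add_left_inj] at this

end AddMonoidAlgebra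

open AddMonoidAlgebra

section

variable {R : Type*} [CommRing R]

/-- Two multiplicative maps out of `ℤ⁴` agree once they agree on the four standard generators. -/
lemma monoidHom_int_four_ext {M : Type*} [CommMonoid M]
    {f g : Multiplicative (ℤ × ℤ × ℤ × ℤ) →* M}
    (h1 : f (.ofAdd (1, 0, 0, 0)) = g (.ofAdd (1, 0, 0, 0)))
    (h2 : f (.ofAdd (0, 1, 0, 0)) = g (.ofAdd (0, 1, 0, 0)))
    (h3 : f (.ofAdd (0, 0, 1, 0)) = g (.ofAdd (0, 0, 1, 0)))
    (h4 : f (.ofAdd (0, 0, 0, 1)) = g (.ofAdd (0, 0, 0, 1))) : f = g := by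
  have key : ∀ v : Multiplicative (ℤ × ℤ × ℤ × ℤ), f v = g v →
      ∀ n : ℤ, f (v ^ n) = g (v ^ n) := by
    intro v hv n
    exact DFunLike.congr_fun (MonoidHom.ext_mint (f := f.comp (zpowersHom _ v))
      (g := g.comp (zpowersHom _ v)) (by simpa using hv)) (.ofAdd n)
  ext v
  obtain ⟨a, b, c, d⟩ := v
  have hv : (Multiplicative.ofAdd (a, b, c, d) : Multiplicative (ℤ × ℤ × ℤ × ℤ)) =
      .ofAdd (1, 0, 0, 0) ^ a * .ofAdd (0, 1, 0, 0) ^ b * .ofAdd (0, 0, 1, 0) ^ c *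
        .ofAdd (0, 0, 0, 1) ^ d := by
    simp [← ofAdd_zsmul, ← ofAdd_add]
  change f (.ofAdd (a, b, c, d)) = g (.ofAdd (a, b, c, d))
  rw [hv]
  simp only [map_mul, key _ h1, key _ h2, key _ h3, key _ h4]

/-- The restriction to monomials of the map from the Reisner–Stanley ring to the fixed points. -/
noncomputable def fixedPointMonomials (R : Type*) [CommRing R] :
    Multiplicative (ℤ × ℤ × ℤ × ℤ) →* (Fin 4 → AddMonoidAlgebra R (ℤ × ℤ)) where
  toFun v := ![single (v.toAdd.1, v.toAdd.2.1) 1, single (-v.toAdd.2.2.1, v.toAdd.2.1) 1,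
    single (-v.toAdd.2.2.1, -v.toAdd.2.2.2) 1, single (v.toAdd.1, -v.toAdd.2.2.2) 1]
  map_one' := by
    funext i
    fin_cases i <;> simp [one_def, Prod.zero_eq_mk]
  map_mul' v w := by
    funext i
    fin_cases i <;> simp [single_mul_single, add_comm]

lemma apply_single_of_generators
    {φ : AddMonoidAlgebra R (ℤ × ℤ × ℤ × ℤ) →ₐ[R] (Fin 4 → AddMonoidAlgebra R (ℤ × ℤ))}
    (hx1 : φ (xMon R (1, 0, 0, 0)) = ![chiMon R (1, 0), 1, 1, chiMon R (1, 0)])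
    (hx2 : φ (xMon R (0, 1, 0, 0)) = ![chiMon R (0, 1), chiMon R (0, 1), 1, 1])
    (hx3 : φ (xMon R (0, 0, 1, 0)) = ![1, chiMon R (-1, 0), chiMon R (-1, 0), 1])
    (hx4 : φ (xMon R (0, 0, 0, 1)) = ![1, 1, chiMon R (0, -1), chiMon R (0, -1)])
    (a b c d : ℤ) (r : R) :
    φ (single (a, b, c, d) r) =
      ![single (a, b) r, single (-c, b) r, single (-c, -d) r, single (a, -d) r] := by
  have h : (φ : AddMonoidAlgebra R (ℤ × ℤ × ℤ × ℤ) →* _).comp (of R _) =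
      fixedPointMonomials R := by
    apply monoidHom_int_four_ext
    · simpa [fixedPointMonomials, one_def, Prod.zero_eq_mk] using hx1
    · simpa [fixedPointMonomials, one_def, Prod.zero_eq_mk] using hx2
    · simpa [fixedPointMonomials, one_def, Prod.zero_eq_mk] using hx3
    · simpa [fixedPointMonomials, one_def, Prod.zero_eq_mk] using hx4
  have h1 := DFunLike.congr_fun h (.ofAdd (a, b, c, d))
  have h2 : (single (a, b, c, d) r : AddMonoidAlgebra R (ℤ × ℤ × ℤ × ℤ)) =
      r • single (a, b, c, d) 1 := by simp
  rw [h2, map_smul]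
  change r • φ (single (a, b, c, d) 1) = _
  change φ (single (a, b, c, d) 1) = _ at h1
  rw [h1]
  funext i
  fin_cases i <;> simp [fixedPointMonomials]

/-- An additive map splitting the map to the fixed points over the GKM subring, obtained from
`x₁ᵃ x₃ᶜ ≡ x₁ᵃ + x₃ᶜ - 1` and `x₂ᵇ x₄ᵈ ≡ x₂ᵇ + x₄ᵈ - 1` modulo the Reisner–Stanley ideal. -/
noncomputable def fixedPointSection (f : Fin 4 → AddMonoidAlgebra R (ℤ × ℤ)) :
    AddMonoidAlgebra R (ℤ × ℤ × ℤ × ℤ) :=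
  mapDomain (fun v => (v.1, v.2, 0, 0)) (f 0) + mapDomain (fun v => (0, v.2, -v.1, 0)) (f 1) +
    mapDomain (fun v => (0, 0, -v.1, -v.2)) (f 2) + mapDomain (fun v => (v.1, 0, 0, -v.2)) (f 3) -
    mapDomain (fun v => (v.1, 0, 0, 0)) (f 0) - mapDomain (fun v => (0, v.2, 0, 0)) (f 0) -
    mapDomain (fun v => (0, 0, -v.1, 0)) (f 2) - mapDomain (fun v => (0, 0, 0, -v.2)) (f 2) +
    mapDomain (fun _ => 0) (f 0)

lemma fixedPointSection_zero :
    fixedPointSection (0 : Fin 4 → AddMonoidAlgebra R (ℤ × ℤ)) = 0 := by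
  simp [fixedPointSection]

lemma fixedPointSection_add (f g : Fin 4 → AddMonoidAlgebra R (ℤ × ℤ)) :
    fixedPointSection (f + g) = fixedPointSection f + fixedPointSection g := by
  simp only [fixedPointSection, Pi.add_apply, mapDomain_add]
  ring

lemma single_sub_fixedPointSection_mem (a b c d : ℤ) (r : R) :
    single (a, b, c, d) r - fixedPointSection
      ![single (a, b) r, single (-c, b) r, single (-c, -d) r, single (a, -d) r] ∈
      Ideal.span {(xMon R (1, 0, 0, 0) - 1) * (xMon R (0, 0, 1, 0) - 1),
                  (xMon R (0, 1, 0, 0) - 1) * (xMon R (0, 0, 0, 1) - 1)} := by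
  have e1 := single_sub_one_dvd_single_zsmul_sub_one (R := R) ((1, 0, 0, 0) : ℤ × ℤ × ℤ × ℤ) a
  have e2 := single_sub_one_dvd_single_zsmul_sub_one (R := R) ((0, 1, 0, 0) : ℤ × ℤ × ℤ × ℤ) b
  have e3 := single_sub_one_dvd_single_zsmul_sub_one (R := R) ((0, 0, 1, 0) : ℤ × ℤ × ℤ × ℤ) c
  have e4 := single_sub_one_dvd_single_zsmul_sub_one (R := R) ((0, 0, 0, 1) : ℤ × ℤ × ℤ × ℤ) d
  simp only [Prod.smul_mk, smul_eq_mul, mul_one, mul_zero] at e1 e2 e3 e4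
  obtain ⟨u, hu⟩ := mul_dvd_mul e1 e3
  obtain ⟨w, hw⟩ := mul_dvd_mul e2 e4
  refine Ideal.mem_span_pair.2 ⟨u * single (0, b, 0, d) r,
    w * single 0 r * (single (a, 0, 0, 0) 1 + single (0, 0, c, 0) 1 - 1), ?_⟩
  have hbd : (single (0, b, 0, d) r : AddMonoidAlgebra R (ℤ × ℤ × ℤ × ℤ)) =
    single (0, b, 0, 0) 1 * single (0, 0, 0, d) 1 * single 0 r := by simp [single_mul_single]
  have key : u * single (0, b, 0, d) r * ((xMon R (1, 0, 0, 0) - 1) * (xMon R (0, 0, 1, 0) - 1)) +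
      w * single 0 r * (single (a, 0, 0, 0) 1 + single (0, 0, c, 0) 1 - 1) *
        ((xMon R (0, 1, 0, 0) - 1) * (xMon R (0, 0, 0, 1) - 1)) =
      (single (a, 0, 0, 0) 1 * single (0, 0, c, 0) 1 * single (0, b, 0, 0) 1 *
        single (0, 0, 0, d) 1 -
      (single (a, 0, 0, 0) 1 + single (0, 0, c, 0) 1 - 1) *
        (single (0, b, 0, 0) 1 + single (0, 0, 0, d) 1 - 1)) * single 0 r := by
    rw [hbd]
    linear_combination (-(single (0, b, 0, 0) 1 * single (0, 0, 0, d) 1 * single 0 r)) * hu -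
      (single 0 r * (single (a, 0, 0, 0) 1 + single (0, 0, c, 0) 1 - 1)) * hw
  rw [key]
  simp [fixedPointSection, sub_mul, mul_sub, add_mul, mul_add, single_mul_single,
    mapDomain_single]
  abel

end


theorem stmt_2 (R : Type*) [CommRing R]
    -- φ is the R-algebra homomorphism determined by
    -- x₁ ↦ (χ₁,1,1,χ₁), x₂ ↦ (χ₂,χ₂,1,1), x₃ ↦ (1,χ₁⁻¹,χ₁⁻¹,1), x₄ ↦ (1,1,χ₂⁻¹,χ₂⁻¹)
    (φ : AddMonoidAlgebra R (ℤ × ℤ × ℤ × ℤ) →ₐ[R] (Fin 4 → AddMonoidAlgebra R (ℤ × ℤ)))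
    (hx1 : φ (xMon R (1, 0, 0, 0)) = ![chiMon R (1, 0), 1, 1, chiMon R (1, 0)])
    (hx2 : φ (xMon R (0, 1, 0, 0)) = ![chiMon R (0, 1), chiMon R (0, 1), 1, 1])
    (hx3 : φ (xMon R (0, 0, 1, 0)) = ![1, chiMon R (-1, 0), chiMon R (-1, 0), 1])
    (hx4 : φ (xMon R (0, 0, 0, 1)) = ![1, 1, chiMon R (0, -1), chiMon R (0, -1)]) :
    -- the kernel of φ is the ideal generated by (x₁ − 1)(x₃ − 1) and (x₂ − 1)(x₄ − 1)
    RingHom.ker φ =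
      Ideal.span {(xMon R (1, 0, 0, 0) - 1) * (xMon R (0, 0, 1, 0) - 1),
                  (xMon R (0, 1, 0, 0) - 1) * (xMon R (0, 0, 0, 1) - 1)} ∧
    -- the image of φ equals the subring
    -- {(f₁,f₂,f₃,f₄) ∈ A⁴ : f₁−f₂ ∈ (1−χ₁)A, f₂−f₃ ∈ (1−χ₂)A, f₃−f₄ ∈ (1−χ₁)A, f₄−f₁ ∈ (1−χ₂)A}
    (φ.range : Set (Fin 4 → AddMonoidAlgebra R (ℤ × ℤ))) =
      {f | f 0 - f 1 ∈ Ideal.span {1 - chiMon R (1, 0)} ∧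
           f 1 - f 2 ∈ Ideal.span {1 - chiMon R (0, 1)} ∧
           f 2 - f 3 ∈ Ideal.span {1 - chiMon R (1, 0)} ∧
           f 3 - f 0 ∈ Ideal.span {1 - chiMon R (0, 1)}} := by
  have hφ := apply_single_of_generators hx1 hx2 hx3 hx4
  have hsec : ∀ x, x - fixedPointSection (φ x) ∈
      Ideal.span {(xMon R (1, 0, 0, 0) - 1) * (xMon R (0, 0, 1, 0) - 1),
                  (xMon R (0, 1, 0, 0) - 1) * (xMon R (0, 0, 0, 1) - 1)} := by
    intro x
    induction x using induction_linear with
    | zero => simp [fixedPointSection_zero]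
    | add x y hx hy =>
      rw [map_add, fixedPointSection_add, add_sub_add_comm]
      exact add_mem hx hy
    | single v r =>
      obtain ⟨a, b, c, d⟩ := v
      rw [hφ]
      exact single_sub_fixedPointSection_mem a b c d r
  have hmap : ∀ (k : ℤ × ℤ → ℤ × ℤ × ℤ × ℤ) (x : AddMonoidAlgebra R (ℤ × ℤ)),
      φ (mapDomain k x) =
        ![mapDomain (fun v => ((k v).1, (k v).2.1)) x,
          mapDomain (fun v => (-(k v).2.2.1, (k v).2.1)) x,
          mapDomain (fun v => (-(k v).2.2.1, -(k v).2.2.2)) x,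
          mapDomain (fun v => ((k v).1, -(k v).2.2.2)) x] := by
    intro k x
    induction x using induction_linear with
    | zero =>
      funext i
      fin_cases i <;> simp
    | add x y hx hy =>
      rw [mapDomain_add, map_add, hx, hy]
      simp [mapDomain_add]
    | single v r => simp [mapDomain_single, hφ]
  refine ⟨le_antisymm ?_ ?_, Set.Subset.antisymm ?_ ?_⟩
  · intro x hx
    have h := hsec x
    rwa [(RingHom.mem_ker).1 hx, fixedPointSection_zero, sub_zero] at h
  · rw [Ideal.span_le]
    rintro x (rfl | rfl)
    · rw [SetLike.mem_coe, RingHom.mem_ker, map_mul, map_sub, map_sub, hx1, hx3, map_one]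
      funext i
      fin_cases i <;> simp [-Matrix.cons_sub, -Matrix.sub_cons]
    · rw [SetLike.mem_coe, RingHom.mem_ker, map_mul, map_sub, map_sub, hx2, hx4, map_one]
      funext i
      fin_cases i <;> simp [-Matrix.cons_sub, -Matrix.sub_cons]
  · rintro _ ⟨x, rfl⟩
    change φ x 0 - φ x 1 ∈ _ ∧ φ x 1 - φ x 2 ∈ _ ∧ φ x 2 - φ x 3 ∈ _ ∧ φ x 3 - φ x 0 ∈ _
    induction x using induction_linear with
    | zero => simp
    | add x y hx hy =>
      simp only [map_add, Pi.add_apply, add_sub_add_comm]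
      exact ⟨add_mem hx.1 hy.1, add_mem hx.2.1 hy.2.1, add_mem hx.2.2.1 hy.2.2.1,
        add_mem hx.2.2.2 hy.2.2.2⟩
    | single v r =>
      obtain ⟨a, b, c, d⟩ := v
      rw [hφ]
      exact ⟨single_sub_single_mem_span (a + c) (by simp) r,
        single_sub_single_mem_span (b + d) (by simp) r,
        single_sub_single_mem_span (-c - a) (by simp) r,
        single_sub_single_mem_span (-d - b) (by simp) r⟩
  · rintro f ⟨h01, h12, h23, h30⟩
    refine ⟨fixedPointSection f, ?_⟩
    have k01 := mapDomain_eq_of_sub_mem_span (fun v : ℤ × ℤ => ((0 : ℤ), v.2)) (by simp) h01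
    have k12 := mapDomain_eq_of_sub_mem_span (fun v : ℤ × ℤ => (v.1, (0 : ℤ))) (by simp) h12
    have k23 := mapDomain_eq_of_sub_mem_span (fun v : ℤ × ℤ => ((0 : ℤ), v.2)) (by simp) h23
    have k30 := mapDomain_eq_of_sub_mem_span (fun v : ℤ × ℤ => (v.1, (0 : ℤ))) (by simp) h30
    have z01 := mapDomain_eq_of_sub_mem_span (fun _ : ℤ × ℤ => ((0 : ℤ), (0 : ℤ))) (by simp) h01
    have z12 := mapDomain_eq_of_sub_mem_span (fun _ : ℤ × ℤ => ((0 : ℤ), (0 : ℤ))) (by simp) h12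
    have z23 := mapDomain_eq_of_sub_mem_span (fun _ : ℤ × ℤ => ((0 : ℤ), (0 : ℤ))) (by simp) h23
    have hid : ∀ x : AddMonoidAlgebra R (ℤ × ℤ), mapDomain (fun v => (v.1, v.2)) x = x := by
      intro x
      induction x using induction_linear with
      | zero => simp
      | add x y hx hy => rw [mapDomain_add, hx, hy]
      | single v r => simp [mapDomain_single]
    change φ (fixedPointSection f) = f
    simp only [fixedPointSection, map_add, map_sub, hmap]
    funext i
    fin_cases i <;>
      simp only [Pi.add_apply, Pi.sub_apply, Fin.zero_eta, Fin.mk_one, Fin.reduceFinMk,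
        Matrix.cons_val, neg_neg, neg_zero, hid, Prod.fst_zero, Prod.snd_zero]
    · grind
    · grind
    · grind
    · grind
end

section
/- Let R be a commutative ring, let n ≥ 1 be an integer, and let A = R[χ₁^{±1}, χ₂^{±1}] be the Laurent polynomial ring in two variables. The R-algebra homomorphism φ from R[x₁^{±1}, x₂^{±1}, x₃^{±1}, x₄^{±1}] to the product ring A⁴ determined by x₁ ↦ (χ₁, 1, 1, χ₁), x₂ ↦ (χ₂, χ₁^{n}χ₂, 1, 1), x₃ ↦ (1, χ₁^{−1}, χ₁^{−1}, 1), x₄ ↦ (1, 1, χ₁^{−n}χ₂^{−1}, χ₂^{−1}) has kernel equal to the ideal generated by (x₁ − 1)(x₃ − 1) and (x₂ − 1)(x₄ − 1), and its image equals the subring {(f₁, f₂, f₃, f₄) ∈ A⁴ : f₁ − f₂ ∈ (1 − χ₁)A, f₂ − f₃ ∈ (1 − χ₁^{n}χ₂)A, f₃ − f₄ ∈ (1 − χ₁)A, f₄ − f₁ ∈ (1 − χ₂)A}. -/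
namespace AddMonoidAlgebra

variable {R G H : Type*} [CommRing R] [AddCommGroup G] [AddCommGroup H]

lemma one_sub_single_dvd_one_sub_single_zsmul (w : G) (k : ℤ) :
    (1 - single w 1 : AddMonoidAlgebra R G) ∣ 1 - single (k • w) 1 := by
  have natCase (m : ℕ) : (1 - single w 1 : AddMonoidAlgebra R G) ∣ 1 - single (m • w) 1 := by
    simpa [single_pow] using one_sub_dvd_one_sub_pow (single w 1 : AddMonoidAlgebra R G) m
  obtain ⟨m, rfl | rfl⟩ := k.eq_nat_or_neg
  · simpa using natCase m
  · have h : (1 - single ((-(m : ℤ)) • w) 1 : AddMonoidAlgebra R G) =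
        (1 - single (m • w) 1) * -single ((-(m : ℤ)) • w) 1 := by
      simp [sub_mul, single_mul_single, one_def]
    exact h ▸ (natCase m).mul_right _

/-- Two monomial substitutions that differ by multiples of `w` agree modulo `1 - single w 1`. -/
lemma one_sub_single_dvd_mapDomain_sub_mapDomain {p q : G →+ H} {w : H} (k : G → ℤ)
    (h : ∀ v, q v = p v + k v • w) (x : AddMonoidAlgebra R G) :
    1 - single w 1 ∣ mapDomainAlgHom R R p x - mapDomainAlgHom R R q x := by
  induction x using induction_linear with
  | zero => simp
  | add x y hx hy =>
    simp only [map_add, add_sub_add_comm]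
    exact hx.add hy
  | single v r =>
    have e : mapDomainAlgHom R R p (single v r) - mapDomainAlgHom R R q (single v r) =
        single (p v) r * (1 - single (k v • w) 1) := by
      simp [mul_sub, single_mul_single, h]
    exact e ▸ (one_sub_single_dvd_one_sub_single_zsmul w (k v)).mul_left _

lemma mapDomainAlgHom_comm {K L : Type*} [AddCommGroup K] [AddCommGroup L]
    {p : H →+ L} {q : G →+ H} {p' : K →+ L} {q' : G →+ K} (h : ∀ v, p (q v) = p' (q' v))
    (x : AddMonoidAlgebra R G) :
    mapDomainAlgHom R R p (mapDomainAlgHom R R q x) =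
      mapDomainAlgHom R R p' (mapDomainAlgHom R R q' x) := by
  have e : p.comp q = p'.comp q' := by ext v; exact h v
  have := congrArg (fun r ↦ mapDomainAlgHom R R r x) e
  simpa only [mapDomainAlgHom_comp, AlgHom.comp_apply] using this

lemma mapDomainAlgHom_leftInverse {p : H →+ G} {q : G →+ H} (h : ∀ v, p (q v) = v)
    (x : AddMonoidAlgebra R G) :
    mapDomainAlgHom R R p (mapDomainAlgHom R R q x) = x := by
  rw [mapDomainAlgHom_comm (p' := AddMonoidHom.id G) (q' := AddMonoidHom.id G) h]
  simp only [mapDomainAlgHom_id, AlgHom.id_apply]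

lemma mapDomainAlgHom_single_one (p : G →+ H) (v : G) :
    mapDomainAlgHom R R p (single v 1) = single (p v) 1 := by
  simp

lemma mapDomainAlgHom_one_sub_single (p : G →+ H) (w : G) :
    mapDomainAlgHom R R p (1 - single w 1) = 1 - single (p w) 1 := by
  rw [map_sub, map_one, mapDomainAlgHom_single_one]

/-- The composite `(1 - p)(1 - q)` of two such differences is divisible by the product. -/
lemma mul_dvd_sub_mapDomain_sub_mapDomain {p q : G →+ G} {w w' : G} (k l : G → ℤ)
    (hp : ∀ v, p v = v + k v • w) (hq : ∀ v, q v = v + l v • w') (hqw : q w = w)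
    (x : AddMonoidAlgebra R G) :
    (1 - single w 1) * (1 - single w' 1) ∣
      x - mapDomainAlgHom R R p x - mapDomainAlgHom R R q (x - mapDomainAlgHom R R p x) := by
  obtain ⟨y, hy⟩ := one_sub_single_dvd_mapDomain_sub_mapDomain (p := AddMonoidHom.id G) k hp x
  obtain ⟨z, hz⟩ := one_sub_single_dvd_mapDomain_sub_mapDomain (p := AddMonoidHom.id G) l hq y
  simp only [mapDomainAlgHom_id, AlgHom.id_apply] at hy hz
  have e : mapDomainAlgHom R R q (1 - single w 1) = 1 - single w 1 := by
    rw [mapDomainAlgHom_one_sub_single, hqw]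
  refine ⟨z, ?_⟩
  rw [hy, map_mul, e, ← mul_sub, hz, mul_assoc]

lemma eq_zero_of_one_sub_single_mul_eq_zero {w : G}
    (hw : Function.Injective fun k : ℕ ↦ k • w) {x : AddMonoidAlgebra R G}
    (h : (1 - single w 1) * x = 0) : x = 0 := by
  have step (v : G) : x.coeff (w + v) = x.coeff v := by
    have := congrArg (fun y ↦ y.coeff (w + v)) h
    simp only [sub_mul, one_mul] at this
    simpa [sub_eq_zero] using this
  have iter (v : G) (k : ℕ) : x.coeff (k • w + v) = x.coeff v := by
    induction k with
    | zero => simp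
    | succ k ih => rw [succ_nsmul', add_assoc, step, ih]
  ext v
  by_contra hv
  refine Set.infinite_of_injective_forall_mem (f := fun k : ℕ ↦ k • w + v)
    (fun a b hab ↦ hw (add_right_cancel hab)) (fun k ↦ ?_) x.coeff.support.finite_toSet
  simpa [iter] using hv

/-- If `p` kills `w`, moves points by multiples of `w` and does not send `w'` to a torsion point,
then `1 - single w 1` and `1 - single w' 1` are coprime in the sense of divisibility. -/
lemma mul_dvd_of_one_sub_single_dvd {p : G →+ G} {w w' : G} (k : G → ℤ)
    (hp : ∀ v, p v = v + k v • w) (hpw : p w = 0)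
    (hpw' : Function.Injective fun m : ℕ ↦ m • p w') {x : AddMonoidAlgebra R G}
    (h : 1 - single w 1 ∣ x) (h' : 1 - single w' 1 ∣ x) :
    (1 - single w 1) * (1 - single w' 1) ∣ x := by
  obtain ⟨y, rfl⟩ := h'
  obtain ⟨z, hz⟩ := h
  have hy : mapDomainAlgHom R R p y = 0 := by
    apply eq_zero_of_one_sub_single_mul_eq_zero hpw'
    have := congrArg (mapDomainAlgHom R R p) hz
    rwa [map_mul, map_mul, mapDomainAlgHom_one_sub_single, mapDomainAlgHom_one_sub_single, hpw,
      ← one_def, sub_self, zero_mul] at this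
  have := one_sub_single_dvd_mapDomain_sub_mapDomain (p := AddMonoidHom.id G) k hp y
  rw [hy, mapDomainAlgHom_id, AlgHom.id_apply, sub_zero] at this
  rw [mul_comm]
  exact mul_dvd_mul_left _ this

end AddMonoidAlgebra

namespace Hirzebruch

open AddMonoidAlgebra

variable {R : Type*} [CommRing R]

/-- An algebra homomorphism out of `R[x₁^{±1}, x₂^{±1}, x₃^{±1}, x₄^{±1}]` is determined by its
values on the variables. -/
lemma algHom_ext_xMon {B : Type*} [Semiring B] [Algebra R B]
    {f g : AddMonoidAlgebra R (ℤ × ℤ × ℤ × ℤ) →ₐ[R] B}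
    (h₁ : f (xMon R (1, 0, 0, 0)) = g (xMon R (1, 0, 0, 0)))
    (h₂ : f (xMon R (0, 1, 0, 0)) = g (xMon R (0, 1, 0, 0)))
    (h₃ : f (xMon R (0, 0, 1, 0)) = g (xMon R (0, 0, 1, 0)))
    (h₄ : f (xMon R (0, 0, 0, 1)) = g (xMon R (0, 0, 0, 1))) : f = g := by
  let S : AddSubgroup (ℤ × ℤ × ℤ × ℤ) :=
    { carrier := {v | f (xMon R v) = g (xMon R v)}
      zero_mem' := by
        change f 1 = g 1
        rw [map_one, map_one]
      add_mem' := by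
        intro v w hv hw
        have e : xMon R (v + w) = xMon R v * xMon R w := by simp [single_mul_single]
        simp only [Set.mem_ofPred_eq] at hv hw ⊢
        rw [e, map_mul, map_mul, hv, hw]
      neg_mem' := by
        intro v hv
        simp only [Set.mem_ofPred_eq] at hv ⊢
        have e : xMon R (-v) * xMon R v = 1 := by simp [single_mul_single, one_def]
        have e' : xMon R v * xMon R (-v) = 1 := by rw [mul_comm, e]
        refine left_inv_eq_right_inv (a := f (xMon R v)) ?_ ?_
        · rw [← map_mul, e, map_one]
        · rw [hv, ← map_mul, e', map_one] }
  refine AddMonoidAlgebra.algHom_ext (fun v ↦ ?_) (Subsingleton.elim _ _)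
  have hv : v = v.1 • ((1, 0, 0, 0) : ℤ × ℤ × ℤ × ℤ) + v.2.1 • (0, 1, 0, 0) + v.2.2.1 • (0, 0, 1, 0) +
      v.2.2.2 • (0, 0, 0, 1) := by
    ext <;> simp
  have : v ∈ S := by
    rw [hv]
    exact S.add_mem (S.add_mem (S.add_mem (S.zsmul_mem h₁ _) (S.zsmul_mem h₂ _))
      (S.zsmul_mem h₃ _)) (S.zsmul_mem h₄ _)
  exact this

/-- Restriction to the fixed point of the cone spanned by the first two rays, on exponents. -/
def res₁ : ℤ × ℤ × ℤ × ℤ →+ ℤ × ℤ :=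
  AddMonoidHom.mk' (fun v ↦ (v.1, v.2.1)) (by intros; ext <;> simp)

/-- Restriction to the fixed point of the cone spanned by the second and third rays, on
exponents. -/
def res₂ (n : ℤ) : ℤ × ℤ × ℤ × ℤ →+ ℤ × ℤ :=
  AddMonoidHom.mk' (fun v ↦ (n * v.2.1 - v.2.2.1, v.2.1)) (by intros; ext <;> simp; ring)

/-- Restriction to the fixed point of the cone spanned by the third and fourth rays, on
exponents. -/
def res₃ (n : ℤ) : ℤ × ℤ × ℤ × ℤ →+ ℤ × ℤ :=
  AddMonoidHom.mk' (fun v ↦ (-v.2.2.1 - n * v.2.2.2, -v.2.2.2))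
    (by intros; ext <;> simp <;> ring)

/-- Restriction to the fixed point of the cone spanned by the fourth and first rays, on
exponents. -/
def res₄ : ℤ × ℤ × ℤ × ℤ →+ ℤ × ℤ :=
  AddMonoidHom.mk' (fun v ↦ (v.1, -v.2.2.2)) (by intros; ext <;> simp; ring)

/-- The section of `res₁` supported on the first two variables. -/
def sec₁ : ℤ × ℤ →+ ℤ × ℤ × ℤ × ℤ :=
  AddMonoidHom.mk' (fun u ↦ (u.1, u.2, 0, 0)) (by intros; ext <;> simp)

/-- The section of `res₂` supported on the second and third variables. -/
def sec₂ (n : ℤ) : ℤ × ℤ →+ ℤ × ℤ × ℤ × ℤ :=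
  AddMonoidHom.mk' (fun u ↦ (0, u.2, n * u.2 - u.1, 0)) (by intros; ext <;> simp; ring)

/-- The section of `res₃` supported on the third and fourth variables. -/
def sec₃ (n : ℤ) : ℤ × ℤ →+ ℤ × ℤ × ℤ × ℤ :=
  AddMonoidHom.mk' (fun u ↦ (0, 0, n * u.2 - u.1, -u.2)) (by intros; ext <;> simp <;> ring)

/-- The section of `res₄` supported on the fourth and first variables. -/
def sec₄ : ℤ × ℤ →+ ℤ × ℤ × ℤ × ℤ :=
  AddMonoidHom.mk' (fun u ↦ (u.1, 0, 0, -u.2)) (by intros; ext <;> simp; ring)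

/-- The substitution `x₁ = 1` on exponents. -/
def kill₁ : ℤ × ℤ × ℤ × ℤ →+ ℤ × ℤ × ℤ × ℤ :=
  AddMonoidHom.mk' (fun v ↦ (0, v.2.1, v.2.2.1, v.2.2.2)) (by intros; ext <;> simp)

/-- The substitution `x₂ = 1` on exponents. -/
def kill₂ : ℤ × ℤ × ℤ × ℤ →+ ℤ × ℤ × ℤ × ℤ :=
  AddMonoidHom.mk' (fun v ↦ (v.1, 0, v.2.2.1, v.2.2.2)) (by intros; ext <;> simp)

/-- The substitution `x₃ = 1` on exponents. -/
def kill₃ : ℤ × ℤ × ℤ × ℤ →+ ℤ × ℤ × ℤ × ℤ :=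
  AddMonoidHom.mk' (fun v ↦ (v.1, v.2.1, 0, v.2.2.2)) (by intros; ext <;> simp)

/-- The substitution `x₄ = 1` on exponents. -/
def kill₄ : ℤ × ℤ × ℤ × ℤ →+ ℤ × ℤ × ℤ × ℤ :=
  AddMonoidHom.mk' (fun v ↦ (v.1, v.2.1, v.2.2.1, 0)) (by intros; ext <;> simp)

/-- An element vanishing at the four fixed points lies in the Reisner–Stanley ideal. -/
lemma mem_span_of_res_eq_zero (n : ℤ) {x : AddMonoidAlgebra R (ℤ × ℤ × ℤ × ℤ)}
    (h₁ : mapDomainAlgHom R R res₁ x = 0) (h₂ : mapDomainAlgHom R R (res₂ n) x = 0)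
    (h₃ : mapDomainAlgHom R R (res₃ n) x = 0) (h₄ : mapDomainAlgHom R R res₄ x = 0) :
    x ∈ Ideal.span {(xMon R (1, 0, 0, 0) - 1) * (xMon R (0, 0, 1, 0) - 1),
      (xMon R (0, 1, 0, 0) - 1) * (xMon R (0, 0, 0, 1) - 1)} := by
  have k₂₁ : mapDomainAlgHom R R kill₂ (mapDomainAlgHom R R kill₁ x) = 0 := by
    rw [mapDomainAlgHom_comm (p' := sec₃ n) (q' := res₃ n), h₃, map_zero]
    intro v; ext <;> simp [kill₁, kill₂, sec₃, res₃]; ring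
  have k₂₃ : mapDomainAlgHom R R kill₂ (mapDomainAlgHom R R kill₃ x) = 0 := by
    rw [mapDomainAlgHom_comm (p' := sec₄) (q' := res₄), h₄, map_zero]
    intro v; ext <;> simp [kill₂, kill₃, sec₄, res₄]
  have k₄₁ : mapDomainAlgHom R R kill₄ (mapDomainAlgHom R R kill₁ x) = 0 := by
    rw [mapDomainAlgHom_comm (p' := sec₂ n) (q' := res₂ n), h₂, map_zero]
    intro v; ext <;> simp [kill₁, kill₄, sec₂, res₂]
  have k₄₃ : mapDomainAlgHom R R kill₄ (mapDomainAlgHom R R kill₃ x) = 0 := by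
    rw [mapDomainAlgHom_comm (p' := sec₁) (q' := res₁), h₁, map_zero]
    intro v; ext <;> simp [kill₃, kill₄, sec₁, res₁]
  have c₂₃ (y : AddMonoidAlgebra R (ℤ × ℤ × ℤ × ℤ)) :
      mapDomainAlgHom R R kill₂ (mapDomainAlgHom R R kill₃ y) =
        mapDomainAlgHom R R kill₃ (mapDomainAlgHom R R kill₂ y) :=
    mapDomainAlgHom_comm (fun v ↦ by ext <;> simp [kill₂, kill₃]) y
  have c₄₃ (y : AddMonoidAlgebra R (ℤ × ℤ × ℤ × ℤ)) :
      mapDomainAlgHom R R kill₄ (mapDomainAlgHom R R kill₃ y) =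
        mapDomainAlgHom R R kill₃ (mapDomainAlgHom R R kill₄ y) :=
    mapDomainAlgHom_comm (fun v ↦ by ext <;> simp [kill₄, kill₃]) y
  obtain ⟨s, hs⟩ := mul_dvd_sub_mapDomain_sub_mapDomain (R := R) (p := kill₁) (q := kill₃)
    (w := (1, 0, 0, 0)) (w' := (0, 0, 1, 0)) (fun v ↦ -v.1) (fun v ↦ -v.2.2.1)
    (fun v ↦ by ext <;> simp [kill₁]) (fun v ↦ by ext <;> simp [kill₃]) (by simp [kill₃]) x
  obtain ⟨y, hy⟩ : ∃ y, y = mapDomainAlgHom R R kill₁ x +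
    mapDomainAlgHom R R kill₃ (x - mapDomainAlgHom R R kill₁ x) := ⟨_, rfl⟩
  have k₂ : mapDomainAlgHom R R kill₂ y = 0 := by
    simp only [hy, map_add, map_sub, k₂₁, k₂₃, c₂₃ (mapDomainAlgHom R R kill₁ x), map_zero,
      sub_zero, add_zero]
  have k₄ : mapDomainAlgHom R R kill₄ y = 0 := by
    simp only [hy, map_add, map_sub, k₄₁, k₄₃, c₄₃ (mapDomainAlgHom R R kill₁ x), map_zero,
      sub_zero, add_zero]
  obtain ⟨t, ht⟩ := mul_dvd_sub_mapDomain_sub_mapDomain (R := R) (p := kill₂) (q := kill₄)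
    (w := (0, 1, 0, 0)) (w' := (0, 0, 0, 1)) (fun v ↦ -v.2.1) (fun v ↦ -v.2.2.2)
    (fun v ↦ by ext <;> simp [kill₂]) (fun v ↦ by ext <;> simp [kill₄]) (by simp [kill₄]) y
  rw [k₂, sub_zero, k₄, sub_zero] at ht
  rw [Ideal.mem_span_pair]
  exact ⟨s, t, by linear_combination -hs - ht + hy⟩

/-- The GKM condition on a tuple of Laurent polynomials. -/
def IsGKM (n : ℤ) (f : Fin 4 → AddMonoidAlgebra R (ℤ × ℤ)) : Prop :=
  1 - chiMon R (1, 0) ∣ f 0 - f 1 ∧ 1 - chiMon R (n, 1) ∣ f 1 - f 2 ∧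
    1 - chiMon R (1, 0) ∣ f 2 - f 3 ∧ 1 - chiMon R (0, 1) ∣ f 3 - f 0

lemma IsGKM.sub {n : ℤ} {f g : Fin 4 → AddMonoidAlgebra R (ℤ × ℤ)} (hf : IsGKM n f)
    (hg : IsGKM n g) : IsGKM n (f - g) := by
  simp only [IsGKM, Pi.sub_apply, sub_sub_sub_comm (f _) (g _)]
  exact ⟨dvd_sub hf.1 hg.1, dvd_sub hf.2.1 hg.2.1, dvd_sub hf.2.2.1 hg.2.2.1,
    dvd_sub hf.2.2.2 hg.2.2.2⟩

variable (R) in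
/-- The localization map to the four fixed points. -/
noncomputable def localization (n : ℤ) :
    AddMonoidAlgebra R (ℤ × ℤ × ℤ × ℤ) →ₐ[R] (Fin 4 → AddMonoidAlgebra R (ℤ × ℤ)) :=
  AlgHom.pi ![mapDomainAlgHom R R res₁, mapDomainAlgHom R R (res₂ n),
    mapDomainAlgHom R R (res₃ n), mapDomainAlgHom R R res₄]

lemma localization_apply (n : ℤ) (x : AddMonoidAlgebra R (ℤ × ℤ × ℤ × ℤ)) :
    localization R n x = ![mapDomainAlgHom R R res₁ x, mapDomainAlgHom R R (res₂ n) x,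
      mapDomainAlgHom R R (res₃ n) x, mapDomainAlgHom R R res₄ x] := by
  funext i
  fin_cases i <;> rfl

lemma chiMon_zero : chiMon R (0, 0) = 1 := rfl

lemma localization_xMon (n : ℤ) (v : ℤ × ℤ × ℤ × ℤ) :
    localization R n (xMon R v) = ![chiMon R (v.1, v.2.1),
      chiMon R (n * v.2.1 - v.2.2.1, v.2.1), chiMon R (-v.2.2.1 - n * v.2.2.2, -v.2.2.2),
      chiMon R (v.1, -v.2.2.2)] := by
  simp only [localization_apply, mapDomainAlgHom_single_one]
  rfl

lemma isGKM_localization (n : ℤ) (x : AddMonoidAlgebra R (ℤ × ℤ × ℤ × ℤ)) :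
    IsGKM n (localization R n x) := by
  rw [localization_apply]
  refine ⟨one_sub_single_dvd_mapDomain_sub_mapDomain (fun v ↦ n * v.2.1 - v.2.2.1 - v.1) ?_ x,
    one_sub_single_dvd_mapDomain_sub_mapDomain (fun v ↦ -v.2.2.2 - v.2.1) ?_ x,
    one_sub_single_dvd_mapDomain_sub_mapDomain (fun v ↦ v.1 + v.2.2.1 + n * v.2.2.2) ?_ x,
    one_sub_single_dvd_mapDomain_sub_mapDomain (fun v ↦ v.2.1 + v.2.2.2) ?_ x⟩ <;>
  · intro v
    ext <;> simp [res₁, res₂, res₃, res₄] <;> ring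

lemma mem_range_of_sub_localization_mem {n : ℤ} {f : Fin 4 → AddMonoidAlgebra R (ℤ × ℤ)}
    (x : AddMonoidAlgebra R (ℤ × ℤ × ℤ × ℤ))
    (h : f - localization R n x ∈ (localization R n).range) : f ∈ (localization R n).range := by
  simpa using add_mem h (AlgHom.mem_range_self (localization R n) x)

lemma localization_x₁_sub_one (n : ℤ) : localization R n (xMon R (1, 0, 0, 0) - 1) =
    ![chiMon R (1, 0) - 1, 0, 0, chiMon R (1, 0) - 1] := by
  rw [map_sub, map_one, localization_xMon]
  funext i
  fin_cases i <;> simp [chiMon_zero]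

lemma localization_x₂_sub_one (n : ℤ) : localization R n (xMon R (0, 1, 0, 0) - 1) =
    ![chiMon R (0, 1) - 1, chiMon R (n, 1) - 1, 0, 0] := by
  rw [map_sub, map_one, localization_xMon]
  funext i
  fin_cases i <;> simp [chiMon_zero]

lemma localization_x₃_sub_one (n : ℤ) : localization R n (xMon R (0, 0, 1, 0) - 1) =
    ![0, chiMon R (-1, 0) - 1, chiMon R (-1, 0) - 1, 0] := by
  rw [map_sub, map_one, localization_xMon]
  funext i
  fin_cases i <;> simp [chiMon_zero]

lemma localization_x₄_sub_one (n : ℤ) : localization R n (xMon R (0, 0, 0, 1) - 1) =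
    ![0, 0, chiMon R (-n, -1) - 1, chiMon R (0, -1) - 1] := by
  rw [map_sub, map_one, localization_xMon]
  funext i
  fin_cases i <;> simp [chiMon_zero]

lemma localization_sec₁ (n : ℤ) (y : AddMonoidAlgebra R (ℤ × ℤ)) :
    localization R n (mapDomainAlgHom R R sec₁ y) 0 = y := by
  rw [localization_apply]
  exact mapDomainAlgHom_leftInverse (fun u ↦ by ext <;> simp [res₁, sec₁]) y

lemma localization_sec₂ (n : ℤ) (y : AddMonoidAlgebra R (ℤ × ℤ)) :
    localization R n (mapDomainAlgHom R R (sec₂ n) y) 1 = y := by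
  rw [localization_apply]
  exact mapDomainAlgHom_leftInverse (fun u ↦ by ext <;> simp [res₂, sec₂]) y

lemma localization_sec₃ (n : ℤ) (y : AddMonoidAlgebra R (ℤ × ℤ)) :
    localization R n (mapDomainAlgHom R R (sec₃ n) y) 2 = y := by
  rw [localization_apply]
  exact mapDomainAlgHom_leftInverse (fun u ↦ by ext <;> simp [res₃, sec₃]) y

lemma localization_sec₄ (n : ℤ) (y : AddMonoidAlgebra R (ℤ × ℤ)) :
    localization R n (mapDomainAlgHom R R sec₄ y) 3 = y := by
  rw [localization_apply]
  exact mapDomainAlgHom_leftInverse (fun u ↦ by ext <;> simp [res₄, sec₄]) y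

lemma chiMon_neg_mul_chiMon (u : ℤ × ℤ) : chiMon R (-u) * chiMon R u = 1 := by
  simp [single_mul_single, one_def]

lemma IsGKM.mem_range_of_eq_zero₁₂₄ {n : ℤ} {f : Fin 4 → AddMonoidAlgebra R (ℤ × ℤ)}
    (hf : IsGKM n f) (h₁ : f 0 = 0) (h₂ : f 1 = 0) (h₄ : f 3 = 0) :
    f ∈ (localization R n).range := by
  have d₁ : 1 - chiMon R (1, 0) ∣ f 2 := by simpa only [h₄, sub_zero] using hf.2.2.1
  have d₂ : 1 - chiMon R (n, 1) ∣ f 2 := by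
    simpa only [h₂, zero_sub, dvd_neg] using hf.2.1
  let p : ℤ × ℤ →+ ℤ × ℤ := AddMonoidHom.mk' (fun u ↦ (0, u.2)) (by intros; ext <;> simp)
  obtain ⟨y, hy⟩ := mul_dvd_of_one_sub_single_dvd (p := p) (fun u ↦ -u.1)
    (fun u ↦ by ext <;> simp [p]) (by simp [p])
    (fun a b hab ↦ by simpa [p] using hab) d₁ d₂
  refine ⟨(xMon R (0, 0, 1, 0) - 1) * (xMon R (0, 0, 0, 1) - 1) *
    mapDomainAlgHom R R (sec₃ n) (chiMon R (1, 0) * chiMon R (n, 1) * y), ?_⟩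
  change localization R n _ = f
  rw [map_mul, map_mul, localization_x₃_sub_one, localization_x₄_sub_one]
  funext i
  rw [Pi.mul_apply, Pi.mul_apply]
  fin_cases i
  · change 0 * 0 * _ = f 0
    rw [h₁, zero_mul, zero_mul]
  · change _ * 0 * _ = f 1
    rw [h₂, mul_zero, zero_mul]
  · change (chiMon R (-(1, 0)) - 1) * (chiMon R (-(n, 1)) - 1) * localization R n _ 2 = f 2
    rw [localization_sec₃, hy]
    linear_combination y * (chiMon R (-(n, 1)) * chiMon R (n, 1) - chiMon R (n, 1)) *
        chiMon_neg_mul_chiMon (R := R) (1, 0) +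
      y * (1 - chiMon R (1, 0)) * chiMon_neg_mul_chiMon (R := R) (n, 1)
  · change 0 * _ * _ = f 3
    rw [h₄, zero_mul, zero_mul]

lemma IsGKM.mem_range_of_eq_zero₁₂ {n : ℤ} {f : Fin 4 → AddMonoidAlgebra R (ℤ × ℤ)}
    (hf : IsGKM n f) (h₁ : f 0 = 0) (h₂ : f 1 = 0) : f ∈ (localization R n).range := by
  have d : 1 - chiMon R (0, 1) ∣ f 3 := by simpa only [h₁, sub_zero] using hf.2.2.2
  obtain ⟨y, hy⟩ := d
  obtain ⟨x, hx⟩ : ∃ x, x = (xMon R (0, 0, 0, 1) - 1) *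
    mapDomainAlgHom R R sec₄ (chiMon R (0, 1) * y) := ⟨_, rfl⟩
  refine mem_range_of_sub_localization_mem x
    ((hf.sub (isGKM_localization n x)).mem_range_of_eq_zero₁₂₄ ?_ ?_ ?_) <;>
  rw [hx, map_mul, localization_x₄_sub_one, Pi.sub_apply, Pi.mul_apply]
  · change f 0 - 0 * _ = 0
    rw [h₁, zero_mul, sub_zero]
  · change f 1 - 0 * _ = 0
    rw [h₂, zero_mul, sub_zero]
  · change f 3 - (chiMon R (-(0, 1)) - 1) * localization R n _ 3 = 0
    rw [localization_sec₄, hy]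
    linear_combination -y * chiMon_neg_mul_chiMon (R := R) (0, 1)

lemma IsGKM.mem_range_of_eq_zero₁ {n : ℤ} {f : Fin 4 → AddMonoidAlgebra R (ℤ × ℤ)}
    (hf : IsGKM n f) (h₁ : f 0 = 0) : f ∈ (localization R n).range := by
  have d : 1 - chiMon R (1, 0) ∣ f 1 := by simpa only [h₁, zero_sub, dvd_neg] using hf.1
  obtain ⟨y, hy⟩ := d
  obtain ⟨x, hx⟩ : ∃ x, x = (xMon R (0, 0, 1, 0) - 1) *
    mapDomainAlgHom R R (sec₂ n) (chiMon R (1, 0) * y) := ⟨_, rfl⟩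
  refine mem_range_of_sub_localization_mem x
    ((hf.sub (isGKM_localization n x)).mem_range_of_eq_zero₁₂ ?_ ?_) <;>
  rw [hx, map_mul, localization_x₃_sub_one, Pi.sub_apply, Pi.mul_apply]
  · change f 0 - 0 * _ = 0
    rw [h₁, zero_mul, sub_zero]
  · change f 1 - (chiMon R (-(1, 0)) - 1) * localization R n _ 1 = 0
    rw [localization_sec₂, hy]
    linear_combination -y * chiMon_neg_mul_chiMon (R := R) (1, 0)

lemma mem_range_localization_iff {n : ℤ} {f : Fin 4 → AddMonoidAlgebra R (ℤ × ℤ)} :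
    f ∈ (localization R n).range ↔ IsGKM n f := by
  refine ⟨?_, fun hf ↦ ?_⟩
  · rintro ⟨x, rfl⟩
    exact isGKM_localization n x
  · refine mem_range_of_sub_localization_mem (mapDomainAlgHom R R sec₁ (f 0))
      ((hf.sub (isGKM_localization n _)).mem_range_of_eq_zero₁ ?_)
    rw [Pi.sub_apply, localization_sec₁, sub_self]

lemma ker_localization (n : ℤ) : RingHom.ker (localization R n) =
    Ideal.span {(xMon R (1, 0, 0, 0) - 1) * (xMon R (0, 0, 1, 0) - 1),
      (xMon R (0, 1, 0, 0) - 1) * (xMon R (0, 0, 0, 1) - 1)} := by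
  refine le_antisymm (fun x hx ↦ ?_) (Ideal.span_le.2 ?_)
  · rw [RingHom.mem_ker, localization_apply] at hx
    exact mem_span_of_res_eq_zero n (congrFun hx 0) (congrFun hx 1) (congrFun hx 2) (congrFun hx 3)
  · rintro _ (rfl | rfl) <;>
    rw [SetLike.mem_coe, RingHom.mem_ker, map_mul]
    · rw [localization_x₁_sub_one, localization_x₃_sub_one]
      funext i
      fin_cases i <;> simp
    · rw [localization_x₂_sub_one, localization_x₄_sub_one]
      funext i
      fin_cases i <;> simp

end Hirzebruch

theorem stmt_3 (R : Type*) [CommRing R] (n : ℕ) (hn : 1 ≤ n)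
    -- φ is the R-algebra homomorphism determined by
    -- x₁ ↦ (χ₁,1,1,χ₁), x₂ ↦ (χ₂,χ₁ⁿχ₂,1,1), x₃ ↦ (1,χ₁⁻¹,χ₁⁻¹,1), x₄ ↦ (1,1,χ₁⁻ⁿχ₂⁻¹,χ₂⁻¹)
    (φ : AddMonoidAlgebra R (ℤ × ℤ × ℤ × ℤ) →ₐ[R] (Fin 4 → AddMonoidAlgebra R (ℤ × ℤ)))
    (hx1 : φ (xMon R (1, 0, 0, 0)) = ![chiMon R (1, 0), 1, 1, chiMon R (1, 0)])
    (hx2 : φ (xMon R (0, 1, 0, 0)) =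
      ![chiMon R (0, 1), chiMon R (1, 0) ^ n * chiMon R (0, 1), 1, 1])
    (hx3 : φ (xMon R (0, 0, 1, 0)) = ![1, chiMon R (-1, 0), chiMon R (-1, 0), 1])
    (hx4 : φ (xMon R (0, 0, 0, 1)) =
      ![1, 1, chiMon R (-1, 0) ^ n * chiMon R (0, -1), chiMon R (0, -1)]) :
    -- the kernel of φ is the ideal generated by (x₁ − 1)(x₃ − 1) and (x₂ − 1)(x₄ − 1)
    RingHom.ker φ =
      Ideal.span {(xMon R (1, 0, 0, 0) - 1) * (xMon R (0, 0, 1, 0) - 1),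
                  (xMon R (0, 1, 0, 0) - 1) * (xMon R (0, 0, 0, 1) - 1)} ∧
    -- the image of φ equals the subring
    -- {(f₁,f₂,f₃,f₄) ∈ A⁴ : f₁−f₂ ∈ (1−χ₁)A, f₂−f₃ ∈ (1−χ₁ⁿχ₂)A, f₃−f₄ ∈ (1−χ₁)A, f₄−f₁ ∈ (1−χ₂)A}
    (φ.range : Set (Fin 4 → AddMonoidAlgebra R (ℤ × ℤ))) =
      {f | f 0 - f 1 ∈ Ideal.span {1 - chiMon R (1, 0)} ∧
           f 1 - f 2 ∈ Ideal.span {1 - chiMon R (1, 0) ^ n * chiMon R (0, 1)} ∧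
           f 2 - f 3 ∈ Ideal.span {1 - chiMon R (1, 0)} ∧
           f 3 - f 0 ∈ Ideal.span {1 - chiMon R (0, 1)}} := by
  have hφ : φ = Hirzebruch.localization R n := by
    apply Hirzebruch.algHom_ext_xMon
    · rw [hx1, Hirzebruch.localization_xMon]
      funext i
      fin_cases i <;> simp [Hirzebruch.chiMon_zero]
    · rw [hx2, Hirzebruch.localization_xMon]
      funext i
      fin_cases i <;>
        simp [Hirzebruch.chiMon_zero, AddMonoidAlgebra.single_pow,
          AddMonoidAlgebra.single_mul_single]
    · rw [hx3, Hirzebruch.localization_xMon]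
      funext i
      fin_cases i <;> simp [Hirzebruch.chiMon_zero]
    · rw [hx4, Hirzebruch.localization_xMon]
      funext i
      fin_cases i <;>
        simp [Hirzebruch.chiMon_zero, AddMonoidAlgebra.single_pow,
          AddMonoidAlgebra.single_mul_single]
  have hχ : chiMon R (1, 0) ^ n * chiMon R (0, 1) = chiMon R ((n : ℤ), 1) := by
    simp [AddMonoidAlgebra.single_pow, AddMonoidAlgebra.single_mul_single]
  subst hφ
  refine ⟨Hirzebruch.ker_localization n, Set.ext fun f ↦ ?_⟩
  simp only [hχ, Ideal.mem_span_singleton]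
  exact Hirzebruch.mem_range_localization_iff
end
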